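/- Fix H > 0, 0 < B < 1, and a, b > 0 with a² ≤ b². Let x(s) = (1/H)·√(1 + B² + 2B·sin(Hs + 3π/2)), z(s) = ∫_{3π/(2H)}^{s + 3π/(2H)} (1 + B·sin(Ht))/√(1 + B² + 2B·sin(Ht)) dt, s₀ = (1/H)·arcsin(−B) + π/(2H), ρ(s) = x(s) − (x'(s)/z'(s))·z(s)·(b²/a²), and z₀ = (1 − B²)/(HB). Suppose z(s₀) ≥ z₀ and let s̄ ∈ (0, s₀] satisfy ρ(s̄) = 0. Then for all s ∈ [−s̄, s̄]: x''(s) ≥ 0, ρ(s) ≥ 0, and z(s)·x'(s) ≥ 0; consequently, with g(s) = −x(s)z'(s) + x'(s)z(s)·(b²/a²), k₁(s) = x'(s)z''(s) − x''(s)z'(s), and k₂(s) = z'(s)/x(s), the pinching inequality ((k₁(s) − k₂(s))²/2)·g(s)² ≤ (1/2)·(2 + (k₁(s) + k₂(s))·g(s))² holds for all s ∈ [−s̄, s̄]. -/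

import Mathlib

open Real

/-- Kenmotsu's profile function `x(s) = (1/H)√(1 + B² + 2B sin(Hs + 3π/2))`. -/
noncomputable def kenX (H B : ℝ) (s : ℝ) : ℝ :=
  (1 / H) * Real.sqrt (1 + B ^ 2 + 2 * B * Real.sin (H * s + 3 * Real.pi / 2))

/-- Kenmotsu's height function
`z(s) = ∫_{3π/(2H)}^{s + 3π/(2H)} (1 + B sin(Ht))/√(1 + B² + 2B sin(Ht)) dt`. -/
noncomputable def kenZ (H B : ℝ) (s : ℝ) : ℝ :=
  ∫ t in (3 * Real.pi / (2 * H))..(s + 3 * Real.pi / (2 * H)),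
    (1 + B * Real.sin (H * t)) / Real.sqrt (1 + B ^ 2 + 2 * B * Real.sin (H * t))

/-- The function `ρ` of the Kenmotsu unduloid. -/
noncomputable def kenRho (H B a b : ℝ) (s : ℝ) : ℝ :=
  kenX H B s - (deriv (kenX H B) s / deriv (kenZ H B) s) * kenZ H B s *
    (b ^ 2 / a ^ 2)

section KenmotsuProfile

variable {H B : ℝ}

/-- The radicand `1 + B² - 2B cos θ` of the Kenmotsu profile is positive for `0 < B < 1`. -/
lemma kenRadicand_pos (hB0 : 0 < B) (hB1 : B < 1) (θ : ℝ) :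
    0 < 1 + B ^ 2 - 2 * B * cos θ := by
  nlinarith [cos_le_one θ, sq_pos_of_pos (sub_pos.2 hB1)]

lemma one_sub_mul_cos_pos (hB0 : 0 < B) (hB1 : B < 1) (θ : ℝ) : 0 < 1 - B * cos θ := by
  nlinarith [cos_le_one θ]

lemma sin_add_three_pi_div_two (θ : ℝ) : sin (θ + 3 * π / 2) = -cos θ := by
  rw [show θ + 3 * π / 2 = θ + π / 2 + π by ring, sin_add_pi, sin_add_pi_div_two]

lemma kenX_eq (s : ℝ) : kenX H B s = (1 / H) * √(1 + B ^ 2 - 2 * B * cos (H * s)) := by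
  rw [kenX, sin_add_three_pi_div_two]
  ring_nf

lemma kenZ_eq (hH : 0 < H) (s : ℝ) : kenZ H B s =
    ∫ t in (0 : ℝ)..s, (1 - B * cos (H * t)) / √(1 + B ^ 2 - 2 * B * cos (H * t)) := by
  have h := intervalIntegral.integral_comp_add_right (a := 0) (b := s)
    (fun t => (1 + B * sin (H * t)) / √(1 + B ^ 2 + 2 * B * sin (H * t))) (3 * π / (2 * H))
  rw [zero_add] at h
  rw [kenZ, ← h]
  refine intervalIntegral.integral_congr fun t _ => ?_
  have e : H * (t + 3 * π / (2 * H)) = H * t + 3 * π / 2 := by field_simp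
  simp only [e, sin_add_three_pi_div_two]
  ring_nf

lemma kenX_neg (s : ℝ) : kenX H B (-s) = kenX H B s := by
  simp [kenX_eq]

lemma kenZ_neg (hH : 0 < H) (s : ℝ) : kenZ H B (-s) = -kenZ H B s := by
  have h := intervalIntegral.integral_comp_neg (a := 0) (b := s)
    (fun t => (1 - B * cos (H * t)) / √(1 + B ^ 2 - 2 * B * cos (H * t)))
  simp only [mul_neg, cos_neg, neg_zero] at h
  rw [kenZ_eq hH, kenZ_eq hH, h, ← intervalIntegral.integral_symm]

lemma kenZ_nonneg (hH : 0 < H) (hB0 : 0 < B) (hB1 : B < 1) {s : ℝ} (hs : 0 ≤ s) :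
    0 ≤ kenZ H B s := by
  rw [kenZ_eq hH]
  exact intervalIntegral.integral_nonneg hs fun t _ =>
    div_nonneg (one_sub_mul_cos_pos hB0 hB1 _).le (sqrt_nonneg _)

lemma hasDerivAt_sin_mul (s : ℝ) : HasDerivAt (fun t => sin (H * t)) (H * cos (H * s)) s := by
  simpa [mul_comm] using ((hasDerivAt_id s).const_mul H).sin

lemma hasDerivAt_cos_mul (s : ℝ) : HasDerivAt (fun t => cos (H * t)) (-(H * sin (H * s))) s := by
  simpa [mul_comm] using ((hasDerivAt_id s).const_mul H).cos

lemma hasDerivAt_sqrt_kenRadicand (hB0 : 0 < B) (hB1 : B < 1) (s : ℝ) :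
    HasDerivAt (fun t => √(1 + B ^ 2 - 2 * B * cos (H * t)))
      (B * H * sin (H * s) / √(1 + B ^ 2 - 2 * B * cos (H * s))) s := by
  have h := (((hasDerivAt_cos_mul (H := H) s).const_mul (2 * B)).const_sub (1 + B ^ 2)).sqrt
    (kenRadicand_pos hB0 hB1 _).ne'
  refine h.congr_deriv ?_
  have := sqrt_pos.2 (kenRadicand_pos hB0 hB1 (H * s))
  field_simp

lemma hasDerivAt_kenX (hH : 0 < H) (hB0 : 0 < B) (hB1 : B < 1) (s : ℝ) :
    HasDerivAt (kenX H B) (B * sin (H * s) / √(1 + B ^ 2 - 2 * B * cos (H * s))) s := by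
  rw [show kenX H B = fun t => (1 / H) * √(1 + B ^ 2 - 2 * B * cos (H * t)) from funext kenX_eq]
  refine ((hasDerivAt_sqrt_kenRadicand hB0 hB1 s).const_mul (1 / H)).congr_deriv ?_
  field_simp

lemma hasDerivAt_kenZ (hH : 0 < H) (hB0 : 0 < B) (hB1 : B < 1) (s : ℝ) :
    HasDerivAt (kenZ H B) ((1 - B * cos (H * s)) / √(1 + B ^ 2 - 2 * B * cos (H * s))) s := by
  rw [show kenZ H B = _ from funext (kenZ_eq hH)]
  have hc : Continuous
      fun t => (1 - B * cos (H * t)) / √(1 + B ^ 2 - 2 * B * cos (H * t)) :=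
    Continuous.div (by fun_prop) (by fun_prop)
      fun t => (sqrt_pos.2 (kenRadicand_pos hB0 hB1 _)).ne'
  exact intervalIntegral.integral_hasDerivAt_right (hc.intervalIntegrable _ _)
    hc.stronglyMeasurable.stronglyMeasurableAtFilter hc.continuousAt

lemma deriv_deriv_kenX (hH : 0 < H) (hB0 : 0 < B) (hB1 : B < 1) (s : ℝ) :
    deriv (deriv (kenX H B)) s = B * H * (cos (H * s) - B) * (1 - B * cos (H * s)) /
      √(1 + B ^ 2 - 2 * B * cos (H * s)) ^ 3 := by
  rw [show deriv (kenX H B) = _ from funext fun t => (hasDerivAt_kenX hH hB0 hB1 t).deriv]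
  have hD := kenRadicand_pos hB0 hB1 (H * s)
  have hr := sqrt_pos.2 hD
  have hr2 := sq_sqrt hD.le
  rw [(((hasDerivAt_sin_mul s).const_mul B).fun_div
    (hasDerivAt_sqrt_kenRadicand hB0 hB1 s) hr.ne').deriv]
  generalize √(1 + B ^ 2 - 2 * B * cos (H * s)) = r at *
  field_simp
  rw [hr2]
  linear_combination -B * sin_sq_add_cos_sq (H * s)

lemma deriv_deriv_kenZ (hH : 0 < H) (hB0 : 0 < B) (hB1 : B < 1) (s : ℝ) :
    deriv (deriv (kenZ H B)) s = -(B ^ 2 * H * sin (H * s) * (cos (H * s) - B)) /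
      √(1 + B ^ 2 - 2 * B * cos (H * s)) ^ 3 := by
  rw [show deriv (kenZ H B) = _ from funext fun t => (hasDerivAt_kenZ hH hB0 hB1 t).deriv]
  have hD := kenRadicand_pos hB0 hB1 (H * s)
  have hr := sqrt_pos.2 hD
  have hr2 := sq_sqrt hD.le
  rw [((((hasDerivAt_cos_mul s).const_mul B).const_sub 1).fun_div
    (hasDerivAt_sqrt_kenRadicand hB0 hB1 s) hr.ne').deriv]
  generalize √(1 + B ^ 2 - 2 * B * cos (H * s)) = r at *
  field_simp
  rw [hr2]
  ring

lemma kenRho_eq (hH : 0 < H) (hB0 : 0 < B) (hB1 : B < 1) (a b s : ℝ) :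
    kenRho H B a b s = kenX H B s -
      B * sin (H * s) / (1 - B * cos (H * s)) * kenZ H B s * (b ^ 2 / a ^ 2) := by
  rw [kenRho, (hasDerivAt_kenX hH hB0 hB1 s).deriv, (hasDerivAt_kenZ hH hB0 hB1 s).deriv,
    div_div_div_cancel_right₀ (sqrt_pos.2 (kenRadicand_pos hB0 hB1 _)).ne']

lemma kenRho_neg (hH : 0 < H) (hB0 : 0 < B) (hB1 : B < 1) (a b s : ℝ) :
    kenRho H B a b (-s) = kenRho H B a b s := by
  rw [kenRho_eq hH hB0 hB1, kenRho_eq hH hB0 hB1, kenX_neg, kenZ_neg hH]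
  simp only [mul_neg, sin_neg, cos_neg]
  ring

lemma hasDerivAt_kenRho (hH : 0 < H) (hB0 : 0 < B) (hB1 : B < 1) (a b s : ℝ) :
    HasDerivAt (kenRho H B a b)
      ((1 - b ^ 2 / a ^ 2) * (B * sin (H * s) / √(1 + B ^ 2 - 2 * B * cos (H * s))) -
        B * H * (cos (H * s) - B) / (1 - B * cos (H * s)) ^ 2 * kenZ H B s *
          (b ^ 2 / a ^ 2)) s := by
  rw [show kenRho H B a b = _ from funext (kenRho_eq hH hB0 hB1 a b)]
  have hq := one_sub_mul_cos_pos hB0 hB1 (H * s)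
  have hr := sqrt_pos.2 (kenRadicand_pos hB0 hB1 (H * s))
  refine ((hasDerivAt_kenX hH hB0 hB1 s).fun_sub
    (((((hasDerivAt_sin_mul s).const_mul B).fun_div
      (((hasDerivAt_cos_mul s).const_mul B).const_sub 1) hq.ne').fun_mul
        (hasDerivAt_kenZ hH hB0 hB1 s)).mul_const (b ^ 2 / a ^ 2))).congr_deriv ?_
  generalize √(1 + B ^ 2 - 2 * B * cos (H * s)) = r at *
  generalize b ^ 2 / a ^ 2 = c
  generalize kenZ H B s = z
  have h1 := sin_sq (H * s)
  generalize sin (H * s) = S at *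
  have e : B * H * (cos (H * s) - B) = B * (H * cos (H * s)) * (1 - B * cos (H * s)) -
      B * S * -(B * -(H * S)) := by
    linear_combination B ^ 2 * H * h1
  rw [e]
  generalize cos (H * s) = C at *
  field_simp
  ring

/-- On the part `0 ≤ s ≤ s₀` of the profile where it is convex, `cos (H s) ≥ B`. -/
lemma le_cos_mul_of_le (hH : 0 < H) (hB0 : 0 < B) (hB1 : B < 1) {s : ℝ} (h0 : 0 ≤ s)
    (hs : s ≤ (1 / H) * arcsin (-B) + π / (2 * H)) : H * s ≤ π ∧ B ≤ cos (H * s) := by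
  have h : H * s ≤ arccos B := by
    have := mul_le_mul_of_nonneg_left hs hH.le
    have e : H * ((1 / H) * arcsin (-B) + π / (2 * H)) = arccos B := by
      rw [arcsin_neg, arccos]
      field_simp
      ring
    rwa [e] at this
  refine ⟨h.trans (arccos_le_pi B), ?_⟩
  have := cos_le_cos_of_nonneg_of_le_pi (mul_nonneg hH.le h0) (arccos_le_pi B) h
  rwa [cos_arccos (by linarith) hB1.le] at this

lemma antitoneOn_kenRho (hH : 0 < H) (hB0 : 0 < B) (hB1 : B < 1) {a b : ℝ} (ha : 0 < a)
    (hab : a ^ 2 ≤ b ^ 2) :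
    AntitoneOn (kenRho H B a b) (Set.Icc 0 ((1 / H) * arcsin (-B) + π / (2 * H))) := by
  have hd := hasDerivAt_kenRho hH hB0 hB1 a b
  refine antitoneOn_of_deriv_nonpos (convex_Icc _ _)
    (fun s _ => (hd s).continuousAt.continuousWithinAt)
    (fun s _ => (hd s).differentiableAt.differentiableWithinAt) fun s hs => ?_
  have hs := interior_subset hs
  obtain ⟨hpi, hcos⟩ := le_cos_mul_of_le hH hB0 hB1 hs.1 hs.2
  have hsin := sin_nonneg_of_nonneg_of_le_pi (mul_nonneg hH.le hs.1) hpi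
  have hz := kenZ_nonneg hH hB0 hB1 hs.1
  have hc : 1 ≤ b ^ 2 / a ^ 2 := (one_le_div (by positivity)).2 hab
  have hcB := sub_nonneg.2 hcos
  rw [(hd s).deriv]
  have h1 : 0 ≤ (b ^ 2 / a ^ 2 - 1) *
      (B * sin (H * s) / √(1 + B ^ 2 - 2 * B * cos (H * s))) :=
    mul_nonneg (sub_nonneg.2 hc) (by positivity)
  have h2 : 0 ≤ B * H * (cos (H * s) - B) / (1 - B * cos (H * s)) ^ 2 * kenZ H B s *
      (b ^ 2 / a ^ 2) := by positivity
  linarith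

end KenmotsuProfile

/-- For the unduloid (`0 < B < 1`) with `a² ≤ b²`: if `z(s₀) ≥ z₀ = (1-B²)/(HB)`
and `s̄ ∈ (0, s₀]` satisfies `ρ(s̄) = 0`, then on `[-s̄, s̄]` one has `x'' ≥ 0`,
`ρ ≥ 0` and `z x' ≥ 0`, and the pinching inequality
`((k₁-k₂)²/2) g² ≤ (1/2)(2 + (k₁+k₂) g)²` holds, where
`g = -x z' + x' z (b²/a²)`, `k₁ = x' z'' - x'' z'` and `k₂ = z'/x`. -/
theorem unduloid_pinching (H B a b : ℝ) (hH : 0 < H) (hB0 : 0 < B)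
    (hB1 : B < 1) (ha : 0 < a) (hb : 0 < b) (hab : a ^ 2 ≤ b ^ 2)
    (hz : kenZ H B ((1 / H) * Real.arcsin (-B) + Real.pi / (2 * H)) ≥
      (1 - B ^ 2) / (H * B))
    (sb : ℝ) (hsb : sb ∈ Set.Ioc 0 ((1 / H) * Real.arcsin (-B) + Real.pi / (2 * H)))
    (hrho : kenRho H B a b sb = 0) :
    ∀ s ∈ Set.Icc (-sb) sb,
      0 ≤ deriv (deriv (kenX H B)) s ∧
      0 ≤ kenRho H B a b s ∧
      0 ≤ kenZ H B s * deriv (kenX H B) s ∧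
      (((deriv (kenX H B) s * deriv (deriv (kenZ H B)) s -
            deriv (deriv (kenX H B)) s * deriv (kenZ H B) s) -
            deriv (kenZ H B) s / kenX H B s) ^ 2 / 2) *
          (-(kenX H B s) * deriv (kenZ H B) s +
            deriv (kenX H B) s * kenZ H B s * (b ^ 2 / a ^ 2)) ^ 2 ≤
        (1 / 2) *
          (2 + ((deriv (kenX H B) s * deriv (deriv (kenZ H B)) s -
              deriv (deriv (kenX H B)) s * deriv (kenZ H B) s) +
              deriv (kenZ H B) s / kenX H B s) *
            (-(kenX H B s) * deriv (kenZ H B) s +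
              deriv (kenX H B) s * kenZ H B s * (b ^ 2 / a ^ 2))) ^ 2 := by
  intro s hs
  have hD := kenRadicand_pos hB0 hB1 (H * s)
  have hr := sqrt_pos.2 hD
  have hr2 := sq_sqrt hD.le
  have hq := one_sub_mul_cos_pos hB0 hB1 (H * s)
  have habs : |s| ≤ sb := abs_le.2 hs
  have habs0 : |s| ≤ (1 / H) * Real.arcsin (-B) + Real.pi / (2 * H) := habs.trans hsb.2
  obtain ⟨hpi, hcos⟩ := le_cos_mul_of_le hH hB0 hB1 (abs_nonneg s) habs0
  have hzsin : 0 ≤ kenZ H B s * sin (H * s) := by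
    have h := mul_nonneg (kenZ_nonneg hH hB0 hB1 (abs_nonneg s))
      (sin_nonneg_of_nonneg_of_le_pi (mul_nonneg hH.le (abs_nonneg s)) hpi)
    rcases abs_choice s with e | e <;> rw [e] at h
    · exact h
    · simpa [kenZ_neg hH] using h
  have hcosB : 0 ≤ cos (H * s) - B := by
    rcases abs_choice s with e | e <;> rw [e] at hcos
    · linarith
    · rw [mul_neg, cos_neg] at hcos
      linarith
  have hrho_nonneg : 0 ≤ kenRho H B a b s := by
    have h := antitoneOn_kenRho hH hB0 hB1 ha hab ⟨abs_nonneg s, habs0⟩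
      ⟨hsb.1.le, hsb.2⟩ habs
    rw [hrho] at h
    rcases abs_choice s with e | e <;> rw [e] at h
    · exact h
    · rwa [kenRho_neg hH hB0 hB1] at h
  have hx2 := deriv_deriv_kenX hH hB0 hB1 s
  have hz2 := deriv_deriv_kenZ hH hB0 hB1 s
  have hx1 := (hasDerivAt_kenX hH hB0 hB1 s).deriv
  have hz1 := (hasDerivAt_kenZ hH hB0 hB1 s).deriv
  have hzx : 0 ≤ kenZ H B s * deriv (kenX H B) s := by
    rw [hx1, show kenZ H B s * (B * sin (H * s) / √(1 + B ^ 2 - 2 * B * cos (H * s))) =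
      B * (kenZ H B s * sin (H * s)) / √(1 + B ^ 2 - 2 * B * cos (H * s)) by ring]
    positivity
  have hx : 0 < kenX H B s := by
    rw [kenX_eq]
    positivity
  have hz1pos : 0 < deriv (kenZ H B) s := hz1 ▸ div_pos hq hr
  have hunit : deriv (kenX H B) s ^ 2 + deriv (kenZ H B) s ^ 2 = 1 := by
    rw [hx1, hz1, div_pow, div_pow, hr2, ← add_div, div_eq_one_iff_eq hD.ne']
    linear_combination B ^ 2 * sin_sq_add_cos_sq (H * s)
  have hx2nonneg : 0 ≤ deriv (deriv (kenX H B)) s := by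
    rw [hx2]
    positivity
  have hk1 : deriv (kenX H B) s * deriv (deriv (kenZ H B)) s -
      deriv (deriv (kenX H B)) s * deriv (kenZ H B) s ≤ 0 := by
    have h : deriv (kenX H B) s * deriv (deriv (kenZ H B)) s ≤ 0 := by
      rw [hx1, hz2, div_mul_div_comm]
      refine div_nonpos_of_nonpos_of_nonneg ?_ (by positivity)
      have : 0 ≤ B ^ 3 * H * sin (H * s) ^ 2 * (cos (H * s) - B) := by positivity
      linarith
    linarith [mul_nonneg hx2nonneg hz1pos.le]
  have hg : -(kenX H B s) * deriv (kenZ H B) s +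
      deriv (kenX H B) s * kenZ H B s * (b ^ 2 / a ^ 2) =
      -(deriv (kenZ H B) s * kenRho H B a b s) := by
    rw [kenRho]
    field_simp
    ring
  have hg_nonpos := hg.trans_le (neg_nonpos.2 (mul_nonneg hz1pos.le hrho_nonneg))
  have hk2g : 0 ≤ 1 + deriv (kenZ H B) s / kenX H B s * (-(kenX H B s) * deriv (kenZ H B) s +
      deriv (kenX H B) s * kenZ H B s * (b ^ 2 / a ^ 2)) := by
    have e : 1 + deriv (kenZ H B) s / kenX H B s * (-(kenX H B s) * deriv (kenZ H B) s +
        deriv (kenX H B) s * kenZ H B s * (b ^ 2 / a ^ 2)) = deriv (kenX H B) s ^ 2 +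
        deriv (kenZ H B) s / kenX H B s * (kenZ H B s * deriv (kenX H B) s) *
          (b ^ 2 / a ^ 2) := by
      rw [← hunit]
      field_simp
      ring
    rw [e]
    positivity
  refine ⟨hx2nonneg, hrho_nonneg, hzx, ?_⟩
  have hk1g := mul_nonneg_of_nonpos_of_nonpos hk1 hg_nonpos
  linarith [mul_nonneg (add_nonneg zero_le_one hk1g) hk2g]
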